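/- Let p be a prime, let k be an algebraically closed field of characteristic p, and let W(k) be the ring of Witt vectors over k. Then the quotient ring W(k)[[t_{11}, t_{12}, t_{21}, t_{22}]]/(p + t_{11}t_{22} − t_{12}t_{21}) of the formal power series ring in four variables over W(k) is an integral domain that is integrally closed in its field of fractions (i.e., it is a normal domain). -/

import Mathlib

open MvPowerSeries

/-- Elementwise complete integral closedness. -/
def CIC (A : Type*) [CommRing A] : Prop :=
  ∀ a b d : A, b ≠ 0 → d ≠ 0 → (∀ n : ℕ, b ^ n ∣ d * a ^ n) → b ∣ a

theorem CIC.isIntegrallyClosed {A : Type*} [CommRing A] [IsDomain A] (h : CIC A) :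
    IsIntegrallyClosed A := by
  rw [isIntegrallyClosed_iff (FractionRing A)]
  intro x hx
  obtain ⟨d, hd, hn⟩ := hx.isAlmostIntegral
  obtain ⟨a, b, hb, rfl⟩ := IsFractionRing.div_surjective (A := A) x
  have hb0 : b ≠ 0 := nonZeroDivisors.ne_zero hb
  have hb1 : algebraMap A (FractionRing A) b ≠ 0 := by simpa using hb0
  obtain ⟨c, rfl⟩ := h a b d hb0 (nonZeroDivisors.ne_zero hd) (by
    intro n
    obtain ⟨c, hc⟩ := hn n
    refine ⟨c, ?_⟩
    apply IsFractionRing.injective A (FractionRing A)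
    rw [Algebra.smul_def, div_pow] at hc
    rw [map_mul, map_mul, map_pow, map_pow, hc]
    field_simp)
  exact ⟨c, by rw [map_mul]; field_simp⟩

theorem CIC.of_field {A : Type*} [CommRing A] (h : IsField A) : CIC A := by
  intro a b d hb _ _
  obtain ⟨c, hc⟩ := h.mul_inv_cancel hb
  exact ⟨c * a, by rw [← mul_assoc, hc, one_mul]⟩

theorem CIC.of_equiv {A B : Type*} [CommRing A] [CommRing B] (e : A ≃+* B) (h : CIC A) :
    CIC B := by
  intro a b d hb hd hn
  have := h (e.symm a) (e.symm b) (e.symm d) (by simpa using hb) (by simpa using hd) (by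
    intro n
    have := map_dvd e.symm (hn n)
    simpa using this)
  simpa using map_dvd e this

section Core
variable {A B : Type*} [CommRing A] [CommRing B] [IsDomain B] (π : A →+* B) (x : A)

theorem core_factor (hker : ∀ a, π a = 0 → x ∣ a) (haus : ∀ a, (∀ n, x ^ n ∣ a) → a = 0)
    (a : A) (ha : a ≠ 0) : ∃ (m : ℕ) (a0 : A), π a0 ≠ 0 ∧ a = x ^ m * a0 := by
  classical
  have h : ∃ n, ¬ x ^ n ∣ a := by
    by_contra! h
    exact ha (haus a h)
  have h1 := Nat.find_spec h
  have h2 : Nat.find h ≠ 0 := by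
    intro h0
    rw [h0] at h1
    simp at h1
  obtain ⟨m, hm⟩ := Nat.exists_eq_succ_of_ne_zero h2
  have h3 := Nat.find_min h (m := m) (by omega)
  push Not at h3
  obtain ⟨a0, rfl⟩ := h3
  refine ⟨m, a0, ?_, rfl⟩
  intro h0
  obtain ⟨c, rfl⟩ := hker a0 h0
  apply h1
  rw [hm, Nat.succ_eq_add_one, pow_succ]
  exact ⟨c, by ring⟩

theorem core_domain (hker : ∀ a, π a = 0 → x ∣ a) (haus : ∀ a, (∀ n, x ^ n ∣ a) → a = 0)
    (nzd : ∀ a, x * a = 0 → a = 0) : IsDomain A := by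
  have hpow : ∀ (n : ℕ) a, x ^ n * a = 0 → a = 0 := by
    intro n
    induction n with
    | zero => intro a; simp
    | succ n ih =>
      intro a h
      rw [pow_succ, mul_assoc] at h
      exact nzd _ (ih _ h)
  have : Nontrivial A := π.domain_nontrivial
  have : NoZeroDivisors A := by
    constructor
    intro a b hab
    by_contra! h
    obtain ⟨m, a0, ha, rfl⟩ := core_factor π x hker haus a h.1
    obtain ⟨l, b0, hb, rfl⟩ := core_factor π x hker haus b h.2
    have h1 : x ^ (m + l) * (a0 * b0) = 0 := by rw [← hab]; ring
    have h2 := congrArg π (hpow _ _ h1)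
    rw [map_mul, map_zero] at h2
    exact mul_ne_zero ha hb h2
  exact NoZeroDivisors.to_isDomain A

theorem core_coprime [IsDomain A] (hx : x ≠ 0) (hx0 : π x = 0) (hker : ∀ a, π a = 0 → x ∣ a)
    (b : A) (hb : π b ≠ 0) (l : ℕ) (y : A) (h : b ∣ x ^ l * y) : b ∣ y := by
  induction l with
  | zero => simpa using h
  | succ l ih =>
    obtain ⟨c, hc⟩ := h
    have h1 : π c = 0 := by
      have := congrArg π hc
      rw [map_mul, map_mul, map_pow, hx0, pow_succ] at this
      simp only [mul_zero, zero_mul] at this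
      exact (mul_eq_zero.mp this.symm).resolve_left hb
    obtain ⟨c', rfl⟩ := hker c h1
    apply ih
    refine ⟨c', mul_left_cancel₀ hx ?_⟩
    rw [← mul_assoc, ← pow_succ', hc]
    ring

theorem core_cic [IsDomain A] (hsurj : Function.Surjective π) (hx : x ≠ 0) (hx0 : π x = 0)
    (hker : ∀ a, π a = 0 → x ∣ a) (haus : ∀ a, (∀ n, x ^ n ∣ a) → a = 0)
    (compl : ∀ c : ℕ → A, ∃ s, ∀ n, x ^ n ∣ s - ∑ i ∈ Finset.range n, x ^ i * c i)
    (hB : CIC B) : CIC A := by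
  -- main case
  have main : ∀ b d : A, π b ≠ 0 → π d ≠ 0 → ∀ a, (∀ n : ℕ, b ^ n ∣ d * a ^ n) → b ∣ a := by
    intro b d hb hd
    have step : ∀ a : {a : A // ∀ n : ℕ, b ^ n ∣ d * a ^ n},
        ∃ (c : A) (a1 : {a : A // ∀ n : ℕ, b ^ n ∣ d * a ^ n}), a.1 = b * c + x * a1.1 := by
      rintro ⟨a, ha⟩
      obtain ⟨c', hc'⟩ := hB (π a) (π b) (π d) hb hd (fun n => by
        simpa using map_dvd π (ha n))
      obtain ⟨c, rfl⟩ := hsurj c'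
      obtain ⟨a1, ha1⟩ := hker (a - b * c) (by rw [map_sub, hc', map_mul, sub_self])
      refine ⟨c, ⟨a1, ?_⟩, ?_⟩
      · intro n
        apply core_coprime π x hx hx0 hker (b ^ n) (by rw [map_pow]; exact pow_ne_zero _ hb) n
        have : x ^ n * (d * a1 ^ n) = d * (a + (-(b * c))) ^ n := by
          rw [← sub_eq_add_neg, ha1]; ring
        rw [this, add_pow, Finset.mul_sum]
        apply Finset.dvd_sum
        intro i hi
        have hi' : i ≤ n := by simpa [Nat.lt_succ_iff] using hi
        obtain ⟨e, he⟩ := ha i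
        refine ⟨e * (-c) ^ (n - i) * (n.choose i), ?_⟩
        have h1 : b ^ n = b ^ i * b ^ (n - i) := by rw [← pow_add]; congr 1; omega
        rw [h1, ← mul_neg, mul_pow]
        linear_combination (b ^ (n - i) * (-c) ^ (n - i) * (n.choose i)) * he
      · simp only; linear_combination ha1
    choose C N hCN using step
    intro a ha
    let seq : ℕ → {a : A // ∀ n : ℕ, b ^ n ∣ d * a ^ n} := fun n => N^[n] ⟨a, ha⟩
    have hseq : ∀ n, a = b * (∑ i ∈ Finset.range n, x ^ i * C (seq i)) + x ^ n * (seq n).1 := by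
      intro n
      induction n with
      | zero => simp [seq]
      | succ n ih =>
        have h1 : seq (n + 1) = N (seq n) := Function.iterate_succ_apply' _ _ _
        rw [Finset.sum_range_succ, h1]
        have h2 := hCN (seq n)
        conv_lhs => rw [ih]
        linear_combination x ^ n * h2
    obtain ⟨s, hs⟩ := compl (fun i => C (seq i))
    refine ⟨s, ?_⟩
    apply sub_eq_zero.mp
    apply haus
    intro n
    obtain ⟨t, ht⟩ := hs n
    refine ⟨(seq n).1 - b * t, ?_⟩
    linear_combination hseq n - b * ht
  intro a b d hb hd hn
  by_cases ha : a = 0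
  · simp [ha]
  obtain ⟨j, a0, ha0, rfl⟩ := core_factor π x hker haus a ha
  obtain ⟨m, b0, hb0, rfl⟩ := core_factor π x hker haus b hb
  obtain ⟨l, d0, hd0, rfl⟩ := core_factor π x hker haus d hd
  have hmj : m ≤ j := by
    by_contra! hlt
    obtain ⟨c, hc⟩ := hn (l + 1)
    have h1 : l + j * (l + 1) < m * (l + 1) := by nlinarith
    obtain ⟨r, hr⟩ := Nat.exists_eq_add_of_lt h1
    have h2 : x ^ (l + j * (l + 1)) * (d0 * a0 ^ (l + 1)) =
        x ^ (l + j * (l + 1)) * (x * (x ^ r * (b0 ^ (l + 1) * c))) := by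
      have h3 : x ^ (m * (l + 1)) = x ^ (l + j * (l + 1)) * (x * x ^ r) := by
        rw [hr]; ring
      have h4 : (x ^ m * b0) ^ (l + 1) * c = x ^ (m * (l + 1)) * (b0 ^ (l + 1) * c) := by
        rw [mul_pow, ← pow_mul]; ring
      rw [h4, h3] at hc
      rw [mul_pow (x ^ j), ← pow_mul] at hc
      rw [pow_add]
      linear_combination hc + (x ^ (l + j * (l+1)) - x ^ l * x ^ (j * (l+1))) * (x * (x ^ r * (b0 ^ (l + 1) * c)))
    have h5 := congrArg π (mul_left_cancel₀ (pow_ne_zero _ hx) h2)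
    rw [map_mul, map_mul, map_pow, hx0, zero_mul] at h5
    exact mul_ne_zero hd0 (pow_ne_zero _ ha0) h5
  obtain ⟨r, rfl⟩ := Nat.exists_eq_add_of_le hmj
  have := main b0 d0 hb0 hd0 (x ^ r * a0) (by
    intro n
    apply core_coprime π x hx hx0 hker (b0 ^ n) (by rw [map_pow]; exact pow_ne_zero _ hb0) l
    obtain ⟨c, hc⟩ := hn n
    refine ⟨c, mul_left_cancel₀ (pow_ne_zero (m * n) hx) ?_⟩
    rw [pow_mul]
    rw [pow_add] at hc
    linear_combination hc)
  rw [pow_add, mul_assoc]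
  exact mul_dvd_mul_left _ this

end Core

/-- `R/(f)` is a completely integrally closed domain. -/
def Good (R : Type*) [CommRing R] (f : R) : Prop :=
  IsDomain (R ⧸ Ideal.span {f}) ∧ CIC (R ⧸ Ideal.span {f})

theorem Good.of_equiv {R S : Type*} [CommRing R] [CommRing S] (e : R ≃+* S) (f : R)
    (h : Good S (e f)) : Good R f := by
  have e' : (S ⧸ Ideal.span {e f}) ≃+* (R ⧸ Ideal.span {f}) :=
    (Ideal.quotientEquiv (Ideal.span {f}) (Ideal.span {e f}) e (by
      rw [Ideal.map_span]; simp)).symm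
  obtain ⟨h1, h2⟩ := h
  exact ⟨e'.symm.toMulEquiv.isDomain _, h2.of_equiv e'⟩

theorem Good.powerSeries {R : Type*} [CommRing R] [IsDomain R] [IsNoetherianRing R]
    (f : PowerSeries R) (hf : PowerSeries.constantCoeff f ≠ 0)
    (h : Good R (PowerSeries.constantCoeff f)) : Good (PowerSeries R) f := by
  obtain ⟨h1, h2⟩ := h
  set f0 := PowerSeries.constantCoeff f with hf0
  set I := Ideal.span {f} with hI
  let q := Ideal.Quotient.mk I
  have hqs : Function.Surjective q := Ideal.Quotient.mk_surjective
  let π : (PowerSeries R ⧸ I) →+* R ⧸ Ideal.span {f0} :=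
    Ideal.Quotient.lift I ((Ideal.Quotient.mk (Ideal.span {f0})).comp PowerSeries.constantCoeff) (by
      intro a ha
      obtain ⟨c, rfl⟩ := Ideal.mem_span_singleton'.mp ha
      rw [RingHom.comp_apply, Ideal.Quotient.eq_zero_iff_mem, map_mul]
      exact Ideal.mul_mem_left _ _ (Ideal.mem_span_singleton_self _))
  have hπ : ∀ a, π (q a) = Ideal.Quotient.mk (Ideal.span {f0}) (PowerSeries.constantCoeff a) :=
    fun a => rfl
  let x := q PowerSeries.X
  have hx0 : π x = 0 := by rw [hπ]; simp
  have hsurj : Function.Surjective π := by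
    intro b
    obtain ⟨b, rfl⟩ := Ideal.Quotient.mk_surjective b
    exact ⟨q (PowerSeries.C b), by rw [hπ]; simp⟩
  have hker : ∀ a, π a = 0 → x ∣ a := by
    intro a ha
    obtain ⟨a, rfl⟩ := hqs a
    rw [hπ, Ideal.Quotient.eq_zero_iff_mem] at ha
    obtain ⟨c, hc⟩ := Ideal.mem_span_singleton'.mp ha
    have : PowerSeries.X ∣ a - PowerSeries.C c * f := by
      rw [PowerSeries.X_dvd_iff, map_sub, map_mul, ← hf0, ← hc]; simp
    have h3 := map_dvd q this
    have h4 : q f = 0 := Ideal.Quotient.eq_zero_iff_mem.mpr (Ideal.mem_span_singleton_self _)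
    rwa [map_sub, map_mul, h4, mul_zero, sub_zero] at h3
  have nzd : ∀ a, x * a = 0 → a = 0 := by
    intro a ha
    obtain ⟨a, rfl⟩ := hqs a
    rw [← map_mul, Ideal.Quotient.eq_zero_iff_mem] at ha
    obtain ⟨c, hc⟩ := Ideal.mem_span_singleton'.mp ha
    have h3 : PowerSeries.constantCoeff c = 0 := by
      have := congrArg PowerSeries.constantCoeff hc
      rw [map_mul, map_mul, PowerSeries.constantCoeff_X, zero_mul] at this
      exact (mul_eq_zero.mp this).resolve_right hf
    obtain ⟨c', rfl⟩ := PowerSeries.X_dvd_iff.mpr h3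
    rw [Ideal.Quotient.eq_zero_iff_mem]
    refine Ideal.mem_span_singleton'.mpr ⟨c', mul_left_cancel₀ PowerSeries.X_ne_zero ?_⟩
    rw [← hc, mul_assoc]
  have haus : ∀ a, (∀ n, x ^ n ∣ a) → a = 0 := by
    intro a ha
    have h3 : a ∈ (⨅ i : ℕ, (Ideal.span {x}) ^ i • (⊤ : Submodule (PowerSeries R ⧸ I) (PowerSeries R ⧸ I))) := by
      rw [Submodule.mem_iInf]
      intro n
      rw [Ideal.span_singleton_pow]
      obtain ⟨c, hc⟩ := ha n
      rw [hc]
      exact Submodule.smul_mem_smul (Ideal.mem_span_singleton_self _) Submodule.mem_top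
    rw [Ideal.mem_iInf_smul_pow_eq_bot_iff] at h3
    obtain ⟨⟨r, hr⟩, hra⟩ := h3
    obtain ⟨s, rfl⟩ := Ideal.mem_span_singleton'.mp hr
    obtain ⟨s, rfl⟩ := hqs s
    have hu : IsUnit (1 - s * PowerSeries.X) := by
      rw [PowerSeries.isUnit_iff_constantCoeff]; simp
    have hu' := hu.map q
    have h5 : q (1 - s * PowerSeries.X) * a = 0 := by
      simp only [smul_eq_mul] at hra
      rw [map_sub, map_one, map_mul]
      linear_combination -hra
    exact (hu'.mul_right_eq_zero).mp h5
  have compl : ∀ c : ℕ → (PowerSeries R ⧸ I),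
      ∃ s, ∀ n, x ^ n ∣ s - ∑ i ∈ Finset.range n, x ^ i * c i := by
    intro c
    choose C hC using fun i => hqs (c i)
    let s : PowerSeries R := PowerSeries.mk fun m =>
      PowerSeries.coeff m (∑ i ∈ Finset.range (m + 1), PowerSeries.X ^ i * C i)
    refine ⟨q s, fun n => ?_⟩
    have : PowerSeries.X ^ n ∣ s - ∑ i ∈ Finset.range n, PowerSeries.X ^ i * C i := by
      rw [PowerSeries.X_pow_dvd_iff]
      intro m hm
      rw [map_sub, PowerSeries.coeff_mk, sub_eq_zero, map_sum, map_sum]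
      apply Finset.sum_subset
      · exact Finset.range_mono (by omega)
      · intro i _ hi
        rw [PowerSeries.coeff_X_pow_mul', if_neg]
        simpa using hi
    have h3 := map_dvd q this
    simpa [hC] using h3
  have hdom : IsDomain (PowerSeries R ⧸ I) := core_domain π x hker haus nzd
  have hx : x ≠ 0 := fun h0 => one_ne_zero (nzd 1 (by rw [h0, zero_mul]))
  exact ⟨hdom, core_cic π x hsurj hx hx0 hker haus compl h2⟩

theorem Good.mv {W : Type*} [CommRing W] [IsDomain W] [IsNoetherianRing W] (n : ℕ)
    (f : MvPowerSeries (Fin (n + 1)) W) (g : MvPowerSeries (Fin n) W)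
    (hg : PowerSeries.constantCoeff (finSuccEquiv W n f) = g) (h0 : g ≠ 0)
    (h : Good _ g) : Good _ f := by
  subst hg
  have : IsDomain (MvPowerSeries (Fin n) W) := NoZeroDivisors.to_isDomain _
  exact Good.of_equiv (finSuccEquiv W n).toRingEquiv f (Good.powerSeries _ h0 h)

theorem natCast_ne (p : ℕ) [Fact p.Prime] (k : Type*) [Field k] [CharP k p] (n : ℕ) :
    (p : MvPowerSeries (Fin n) (WittVector p k)) ≠ 0 := by
  intro h
  have := congrArg (MvPowerSeries.constantCoeff) h
  rw [map_natCast, map_zero] at this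
  exact WittVector.p_nonzero p k this

theorem good_p (p : ℕ) [Fact p.Prime] (k : Type*) [Field k] [IsAlgClosed k] [CharP k p] (n : ℕ) :
    Good (MvPowerSeries (Fin n) (WittVector p k)) p := by
  induction n with
  | zero =>
    apply Good.of_equiv (isEmptyEquiv (Fin 0) (WittVector p k)).toRingEquiv
    have : (Ideal.span {(p : WittVector p k)}).IsMaximal := by
      have := (WittVector.irreducible p (k := k)).maximalIdeal_eq
      rw [← this]; infer_instance
    simp only [map_natCast]
    have hfield : IsField (WittVector p k ⧸ Ideal.span {(p : WittVector p k)}) :=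
      (Ideal.Quotient.maximal_ideal_iff_isField_quotient _).mp this
    exact ⟨hfield.isDomain, CIC.of_field hfield⟩
  | succ n ih =>
    exact Good.mv n _ _ (by simp) (natCast_ne p k n) ih

theorem stmt6 (p : ℕ) [Fact p.Prime] (k : Type*) [Field k] [IsAlgClosed k] [CharP k p]
    (f : MvPowerSeries (Fin 4) (WittVector p k))
    (hf : f = (p : MvPowerSeries (Fin 4) (WittVector p k))
        + MvPowerSeries.X 0 * MvPowerSeries.X 3
        - MvPowerSeries.X 1 * MvPowerSeries.X 2) :
    IsDomain (MvPowerSeries (Fin 4) (WittVector p k) ⧸ Ideal.span {f}) ∧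
      IsIntegrallyClosed (MvPowerSeries (Fin 4) (WittVector p k) ⧸ Ideal.span {f}) := by
  have h3 : Good (MvPowerSeries (Fin 3) (WittVector p k))
      ((p : MvPowerSeries (Fin 3) (WittVector p k)) - MvPowerSeries.X 0 * MvPowerSeries.X 1) := by
    refine Good.mv 2 _ p ?_ (natCast_ne p k 2) (good_p p k 2)
    rw [map_sub, map_mul, finSuccEquiv_X_zero]
    simp
  have h4 : Good (MvPowerSeries (Fin 4) (WittVector p k)) f := by
    refine Good.mv 3 _ _ ?_ ?_ h3
    · have e1 : (1 : Fin 4) = Fin.succ 0 := rfl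
      have e2 : (2 : Fin 4) = Fin.succ 1 := rfl
      rw [hf, map_sub, map_add, map_mul, map_mul, finSuccEquiv_X_zero, e1, e2,
        finSuccEquiv_X_succ, finSuccEquiv_X_succ]
      simp
    · intro h
      have := congrArg (MvPowerSeries.constantCoeff) h
      rw [map_sub, map_natCast, map_zero, map_mul, MvPowerSeries.constantCoeff_X, zero_mul,
        sub_zero] at this
      exact WittVector.p_nonzero p k this
  obtain ⟨hd, hc⟩ := h4
  exact ⟨hd, hc.isIntegrallyClosed⟩
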